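/- arXiv:1505.00196 — 2 statements merged into one kernel-verified Lean document; each statement's English description precedes it below -/
import Mathlib

section
/- Let γ ∈ ℝ, B ≥ 0, λ > 0, and let ν be a Lévy measure on ℝ (i.e. ν({0}) = 0 and ∫_ℝ (1 ∧ x²) ν(dx) < ∞). With τ(x) := x/(1 ∨ |x|), H(r) := |γ r + ∫_ℝ (τ(xr) − r τ(x)) ν(dx)|, and Ψ(r) := sup_{|c| ≤ 1} H(cr) + B r² + ∫_ℝ (1 ∧ |rx|²) ν(dx), let f(s) := e^{−λs} for s ≥ 0 and f(s) := 0 for s < 0. Then ∫_ℝ Ψ(f(s)) ds < ∞ if and only if ∫_{|x|>1} log|x| ν(dx) < ∞. -/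
open MeasureTheory Set Real
open scoped ENNReal

/-- The difference between the truncation of `x * ρ` and `ρ` times the truncation of `x` vanishes
for small `x` and is bounded by `min 1 (r * |x|)` otherwise. -/
lemma abs_truncation_sub_le {ρ r x : ℝ} (hρ : |ρ| ≤ r) (hr : r ≤ 1) :
    |x * ρ / max 1 |x * ρ| - ρ * (x / max 1 |x|)|
      ≤ {x : ℝ | 1 < |x|}.indicator (fun x => min 1 (r * |x|)) x := by
  have hρ1 : |ρ| ≤ 1 := hρ.trans hr
  by_cases hx : 1 < |x|
  · rw [indicator_of_mem (by exact hx), max_eq_right hx.le]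
    have hx0 : 0 < |x| := by linarith
    have hM : 0 < max 1 |x * ρ| := lt_of_lt_of_le one_pos (le_max_left _ _)
    have hfac : x * ρ / max 1 |x * ρ| - ρ * (x / |x|)
        = x * ρ * ((max 1 |x * ρ|)⁻¹ - |x|⁻¹) := by
      field_simp
    have hMx : max 1 |x * ρ| ≤ |x| := by
      refine max_le hx.le ?_
      rw [abs_mul]
      nlinarith
    have hinv : |x|⁻¹ ≤ (max 1 |x * ρ|)⁻¹ := inv_anti₀ hM hMx
    have hle : |(max 1 |x * ρ|)⁻¹ - |x|⁻¹| ≤ (max 1 |x * ρ|)⁻¹ := by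
      rw [abs_of_nonneg (sub_nonneg.2 hinv)]
      linarith [inv_pos.2 hx0]
    rw [hfac, abs_mul]
    refine (mul_le_mul_of_nonneg_left hle (abs_nonneg _)).trans (le_min ?_ ?_)
    · rw [← div_eq_mul_inv, div_le_one hM]
      exact le_max_right _ _
    · have h1 : (max 1 |x * ρ|)⁻¹ ≤ 1 := inv_le_one_of_one_le₀ (le_max_left _ _)
      calc |x * ρ| * (max 1 |x * ρ|)⁻¹ ≤ |x * ρ| * 1 :=
            mul_le_mul_of_nonneg_left h1 (abs_nonneg _)
        _ = |ρ| * |x| := by rw [abs_mul]; ring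
        _ ≤ r * |x| := mul_le_mul_of_nonneg_right hρ hx0.le
  · rw [indicator_of_notMem (by exact hx)]
    have hx' : |x| ≤ 1 := not_lt.1 hx
    have h2 : |x * ρ| ≤ 1 := by
      rw [abs_mul]
      exact mul_le_one₀ hx' (abs_nonneg _) hρ1
    rw [max_eq_left hx', max_eq_left h2]
    simp [mul_comm]

lemma measurableSet_one_lt_abs : MeasurableSet {x : ℝ | 1 < |x|} :=
  measurableSet_lt measurable_const continuous_abs.measurable

lemma integrable_min_one_sq {ν : Measure ℝ}
    (hν : ∫⁻ x, ENNReal.ofReal (min 1 (x ^ 2)) ∂ν < ⊤) :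
    Integrable (fun x : ℝ => min 1 (x ^ 2)) ν :=
  ⟨by fun_prop, (hasFiniteIntegral_iff_ofReal (ae_of_all _ fun x => by positivity)).2 hν⟩

lemma integrable_min_one_mul_sq {ν : Measure ℝ}
    (hν : ∫⁻ x, ENNReal.ofReal (min 1 (x ^ 2)) ∂ν < ⊤) {r : ℝ} (hr : |r| ≤ 1) :
    Integrable (fun x : ℝ => min 1 ((r * x) ^ 2)) ν := by
  refine (integrable_min_one_sq hν).mono' (by fun_prop) (ae_of_all _ fun x => ?_)
  rw [Real.norm_of_nonneg (by positivity), mul_pow]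
  have : r ^ 2 ≤ 1 := (sq_le_one_iff_abs_le_one r).2 hr
  exact min_le_min le_rfl (by nlinarith [sq_nonneg x])

lemma integrable_indicator_min_one {ν : Measure ℝ}
    (hν : ∫⁻ x, ENNReal.ofReal (min 1 (x ^ 2)) ∂ν < ⊤) {r : ℝ} (hr : 0 ≤ r) :
    Integrable ({x : ℝ | 1 < |x|}.indicator fun x => min 1 (r * |x|)) ν := by
  refine (integrable_min_one_sq hν).mono'
    (Measurable.indicator (by fun_prop) measurableSet_one_lt_abs).aestronglyMeasurable
    (ae_of_all _ fun x => ?_)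
  by_cases hx : 1 < |x|
  · rw [indicator_of_mem (by exact hx), Real.norm_of_nonneg (by positivity),
      min_eq_left (b := x ^ 2) ((one_lt_sq_iff_one_lt_abs x).2 hx).le]
    exact min_le_left _ _
  · rw [indicator_of_notMem (by exact hx), norm_zero]
    positivity

lemma isFiniteMeasure_restrict_one_lt_abs {ν : Measure ℝ}
    (hν : ∫⁻ x, ENNReal.ofReal (min 1 (x ^ 2)) ∂ν < ⊤) :
    IsFiniteMeasure (ν.restrict {x : ℝ | 1 < |x|}) := by
  refine ⟨?_⟩
  rw [Measure.restrict_apply_univ, ← setLIntegral_one]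
  refine lt_of_le_of_lt (le_trans ?_ (setLIntegral_le_lintegral {x : ℝ | 1 < |x|} _)) hν
  refine setLIntegral_mono' measurableSet_one_lt_abs fun x hx => ?_
  rw [min_eq_left ((one_lt_sq_iff_one_lt_abs x).2 hx).le, ENNReal.ofReal_one]

/-- The part of the Young function that is quadratic near zero is controlled by a linear term
and the integral of `min 1 (r * |x|)` over the large jumps. -/
lemma integral_min_one_mul_sq_le {ν : Measure ℝ}
    (hν : ∫⁻ x, ENNReal.ofReal (min 1 (x ^ 2)) ∂ν < ⊤) {r : ℝ} (hr : 0 ≤ r) (hr1 : r ≤ 1) :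
    ∫ x, min 1 ((r * x) ^ 2) ∂ν ≤ r * ∫ x, min 1 (x ^ 2) ∂ν
      + ∫ x in {x : ℝ | 1 < |x|}, min 1 (r * |x|) ∂ν := by
  rw [← integral_indicator measurableSet_one_lt_abs, ← integral_const_mul,
    ← integral_add ((integrable_min_one_sq hν).const_mul r) (integrable_indicator_min_one hν hr)]
  refine integral_mono (integrable_min_one_mul_sq hν (by rwa [abs_of_nonneg hr]))
    (((integrable_min_one_sq hν).const_mul r).add (integrable_indicator_min_one hν hr))
    fun x => ?_
  dsimp only
  by_cases hx : 1 < |x|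
  · rw [indicator_of_mem (by exact hx)]
    have h0 : 0 ≤ r * min 1 (x ^ 2) := by positivity
    suffices min 1 ((r * x) ^ 2) ≤ min 1 (r * |x|) by linarith
    refine le_min (min_le_left _ _) ?_
    have hrx : 0 ≤ r * |x| := by positivity
    have hsq : (r * x) ^ 2 = (r * |x|) ^ 2 := by rw [mul_pow, mul_pow, sq_abs]
    rw [hsq]
    rcases le_total (r * |x|) 1 with h | h
    · exact (min_le_right _ _).trans (by nlinarith)
    · exact (min_le_left _ _).trans h
  · rw [indicator_of_notMem (by exact hx), add_zero,
      min_eq_right (a := 1) (b := x ^ 2) ((sq_le_one_iff_abs_le_one x).2 (not_lt.1 hx))]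
    refine (min_le_right _ _).trans ?_
    rw [mul_pow]
    exact mul_le_mul_of_nonneg_right (by nlinarith) (sq_nonneg x)

lemma lintegral_ofReal_exp_kernel_lt_top {lam : ℝ} (hlam : 0 < lam) :
    ∫⁻ s : ℝ, ENNReal.ofReal (if 0 ≤ s then Real.exp (-(lam * s)) else 0) < ⊤ := by
  have h := (integrableOn_Ici_iff_integrableOn_Ioi (μ := volume)).2 (exp_neg_integrableOn_Ioi 0 hlam)
  have h2 := (h.integrable_indicator measurableSet_Ici).lintegral_lt_top
  convert h2 using 4 with s
  simp [indicator_apply, neg_mul]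

lemma measurable_exp_kernel (lam : ℝ) :
    Measurable fun s : ℝ => if 0 ≤ s then Real.exp (-(lam * s)) else 0 :=
  Measurable.ite measurableSet_Ici (by fun_prop) measurable_const

lemma ofReal_log_div_le_lintegral {lam : ℝ} (hlam : 0 < lam) {x : ℝ} (hx : 1 < |x|) :
    ENNReal.ofReal (Real.log |x| / lam) ≤
      ∫⁻ s : ℝ, ENNReal.ofReal
        (min 1 (((if 0 ≤ s then Real.exp (-(lam * s)) else 0) * x) ^ 2)) := by
  have hv : ENNReal.ofReal (Real.log |x| / lam)
      = ∫⁻ s in Icc 0 (Real.log |x| / lam), (1 : ℝ≥0∞) := by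
    rw [setLIntegral_one, Real.volume_Icc, sub_zero]
  rw [hv]
  refine le_trans (setLIntegral_mono' measurableSet_Icc fun s hs => ?_)
    (setLIntegral_le_lintegral _ _)
  rw [if_pos hs.1, min_eq_left, ENNReal.ofReal_one]
  have h1 : lam * s ≤ Real.log |x| := by
    have := (le_div_iff₀ hlam).1 hs.2
    linarith
  rw [one_le_sq_iff_one_le_abs, abs_mul, abs_of_pos (Real.exp_pos _)]
  nth_rewrite 1 [← Real.exp_log (show 0 < |x| by linarith)]
  rw [← Real.exp_add]
  exact Real.one_le_exp (by linarith)

lemma lintegral_min_one_le {lam : ℝ} (hlam : 0 < lam) {x : ℝ} (hx : 1 < |x|) :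
    ∫⁻ s : ℝ, ENNReal.ofReal
        (min 1 ((if 0 ≤ s then Real.exp (-(lam * s)) else 0) * |x|)) ≤
      ENNReal.ofReal (Real.log |x| / lam) +
        ∫⁻ s : ℝ, ENNReal.ofReal (if 0 ≤ s then Real.exp (-(lam * s)) else 0) := by
  set a := Real.log |x| / lam with ha
  have hv : ENNReal.ofReal a = ∫⁻ s, (Icc 0 a).indicator (1 : ℝ → ℝ≥0∞) s := by
    rw [lintegral_indicator_one measurableSet_Icc, Real.volume_Icc, sub_zero]
  rw [hv, ← lintegral_sub_right_eq_self
    (fun s : ℝ => ENNReal.ofReal (if 0 ≤ s then Real.exp (-(lam * s)) else 0)) a,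
    ← lintegral_add_left (measurable_one.indicator measurableSet_Icc)]
  refine lintegral_mono fun s => ?_
  dsimp only
  by_cases h0 : 0 ≤ s
  · by_cases hs : s ≤ a
    · rw [indicator_of_mem (show s ∈ Icc 0 a from ⟨h0, hs⟩)]
      refine le_add_right ?_
      rw [Pi.one_apply, ENNReal.ofReal_le_one]
      exact min_le_left _ _
    · refine le_add_left (ENNReal.ofReal_le_ofReal ((min_le_right _ _).trans ?_))
      rw [if_pos h0, if_pos (by linarith)]
      nth_rewrite 1 [← Real.exp_log (show 0 < |x| by linarith)]
      rw [← Real.exp_add]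
      refine Real.exp_le_exp.2 (le_of_eq ?_)
      rw [ha]
      field_simp
      ring
  · rw [if_neg h0]
    simp

/-- well-definedness of the Lévy-driven OU process, Example 3.1.
For a Lévy triplet `(γ, B, ν)` on `ℝ` with associated Young function `Ψ` and the
exponential kernel `f(s) = e^{-λ s} 𝟙_{s ≥ 0}`, one has `∫ Ψ(f(s)) ds < ∞` iff
`∫_{|x|>1} log|x| ν(dx) < ∞`. -/
theorem exponential_kernel_in_levy_orlicz_iff
    (γ : ℝ) (B : ℝ) (hB : 0 ≤ B) (lam : ℝ) (hlam : 0 < lam)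
    (ν : Measure ℝ)
    (hν_zero : ν {0} = 0)
    (hν_levy : ∫⁻ x, ENNReal.ofReal (min 1 (x ^ 2)) ∂ν < ⊤)
    (τ : ℝ → ℝ) (hτ : ∀ x, τ x = x / max 1 |x|)
    (H : ℝ → ℝ)
    (hH : ∀ r : ℝ, H r = |γ * r + ∫ x, (τ (x * r) - r * τ x) ∂ν|)
    (Ψ : ℝ → ℝ)
    (hΨ : ∀ r : ℝ, Ψ r =
      sSup {y : ℝ | ∃ c : ℝ, |c| ≤ 1 ∧ y = H (c * r)}
        + B * r ^ 2 + ∫ x, min 1 ((r * x) ^ 2) ∂ν)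
    (f : ℝ → ℝ) (hf : ∀ s : ℝ, f s = if 0 ≤ s then Real.exp (-(lam * s)) else 0) :
    (∫⁻ s, ENNReal.ofReal (Ψ (f s)) < ⊤) ↔
      ∫⁻ x in {x : ℝ | 1 < |x|}, ENNReal.ofReal (Real.log |x|) ∂ν < ⊤ := by
  have hfin := isFiniteMeasure_restrict_one_lt_abs hν_levy
  have hfm : Measurable f := by
    rw [show f = _ from funext hf]
    exact measurable_exp_kernel lam
  have hf0 : ∀ s, 0 ≤ f s := fun s => by
    rw [hf]
    split_ifs <;> positivity
  have hf1 : ∀ s, f s ≤ 1 := fun s => by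
    rw [hf]
    split_ifs with h
    · exact Real.exp_le_one_iff.2 (by nlinarith)
    · exact zero_le_one
  have hlog : ∀ x : ℝ, ENNReal.ofReal (Real.log |x| / lam)
      = ENNReal.ofReal (Real.log |x|) * ENNReal.ofReal lam⁻¹ := fun x => by
    rw [div_eq_mul_inv, ENNReal.ofReal_mul' (inv_pos.2 hlam).le]
  constructor
  · intro h
    have hlow : ∀ s, ∫⁻ x in {x : ℝ | 1 < |x|}, ENNReal.ofReal (min 1 ((f s * x) ^ 2)) ∂ν
        ≤ ENNReal.ofReal (Ψ (f s)) := fun s => by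
      refine (setLIntegral_le_lintegral _ _).trans ?_
      rw [← ofReal_integral_eq_lintegral_ofReal
        (integrable_min_one_mul_sq hν_levy (by rw [abs_of_nonneg (hf0 s)]; exact hf1 s))
        (ae_of_all _ fun x => by positivity)]
      refine ENNReal.ofReal_le_ofReal ?_
      rw [hΨ]
      have h1 : 0 ≤ sSup {y : ℝ | ∃ c : ℝ, |c| ≤ 1 ∧ y = H (c * f s)} := by
        refine Real.sSup_nonneg ?_
        rintro y ⟨c, -, rfl⟩
        rw [hH]
        exact abs_nonneg _
      have h2 : 0 ≤ B * f s ^ 2 := by positivity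
      linarith
    have hlt := (lintegral_mono hlow).trans_lt h
    rw [lintegral_lintegral_swap (by fun_prop)] at hlt
    have hlt' : ∫⁻ x in {x : ℝ | 1 < |x|},
        ENNReal.ofReal (Real.log |x|) * ENNReal.ofReal lam⁻¹ ∂ν < ⊤ := by
      refine (setLIntegral_mono' measurableSet_one_lt_abs fun x hx => ?_).trans_lt hlt
      rw [← hlog]
      simp only [hf]
      exact ofReal_log_div_le_lintegral hlam hx
    rw [lintegral_mul_const' _ _ ENNReal.ofReal_ne_top] at hlt'
    refine ENNReal.lt_top_of_mul_ne_top_left hlt'.ne ?_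
    simpa using hlam
  · intro h
    set C := |γ| + B + ∫ x, min 1 (x ^ 2) ∂ν with hC
    have hC0 : 0 ≤ C := by
      have : 0 ≤ ∫ x, min 1 (x ^ 2) ∂ν := integral_nonneg fun x => by positivity
      positivity
    have hup : ∀ s, ENNReal.ofReal (Ψ (f s)) ≤ ENNReal.ofReal C * ENNReal.ofReal (f s)
        + 2 * ∫⁻ x in {x : ℝ | 1 < |x|}, ENNReal.ofReal (min 1 (f s * |x|)) ∂ν := fun s => by
      have hr0 := hf0 s
      have hr1 := hf1 s
      have hint := integrable_indicator_min_one hν_levy hr0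
      set D := ∫ x in {x : ℝ | 1 < |x|}, min 1 (f s * |x|) ∂ν with hD
      have hD0 : 0 ≤ D := integral_nonneg fun x => by positivity
      rw [← ofReal_integral_eq_lintegral_ofReal
        ((integrable_indicator_iff measurableSet_one_lt_abs).1 hint)
        (ae_of_all _ fun x => by positivity), ← hD, ← ENNReal.ofReal_mul hC0,
        ← ENNReal.ofReal_ofNat 2, ← ENNReal.ofReal_mul zero_le_two,
        ← ENNReal.ofReal_add (by positivity) (by positivity)]
      refine ENNReal.ofReal_le_ofReal ?_
      have hsup : sSup {y : ℝ | ∃ c : ℝ, |c| ≤ 1 ∧ y = H (c * f s)} ≤ |γ| * f s + D := by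
        refine csSup_le ⟨_, 0, by simp, rfl⟩ ?_
        rintro y ⟨c, hc, rfl⟩
        have hcr : |c * f s| ≤ f s := by
          rw [abs_mul, abs_of_nonneg hr0]
          exact mul_le_of_le_one_left hr0 hc
        rw [hH]
        refine (abs_add_le _ _).trans (add_le_add ?_ ?_)
        · rw [abs_mul]
          exact mul_le_mul_of_nonneg_left hcr (abs_nonneg _)
        · rw [hD, ← integral_indicator measurableSet_one_lt_abs, ← Real.norm_eq_abs]
          refine norm_integral_le_of_norm_le hint (ae_of_all _ fun x => ?_)
          rw [Real.norm_eq_abs, hτ, hτ]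
          exact abs_truncation_sub_le hcr hr1
      have hquad := integral_min_one_mul_sq_le hν_levy hr0 hr1
      have hBr : B * f s ^ 2 ≤ B * f s := mul_le_mul_of_nonneg_left (by nlinarith) hB
      rw [hΨ, hC]
      linarith
    refine (lintegral_mono hup).trans_lt ?_
    have hK : ∫⁻ s, ENNReal.ofReal (f s) < ⊤ := by
      simpa only [hf] using lintegral_ofReal_exp_kernel_lt_top hlam
    rw [lintegral_add_left (by fun_prop), lintegral_const_mul' _ _ ENNReal.ofReal_ne_top,
      lintegral_const_mul' _ _ ENNReal.ofNat_ne_top,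
      lintegral_lintegral_swap (by fun_prop)]
    refine ENNReal.add_lt_top.2 ⟨ENNReal.mul_lt_top ENNReal.ofReal_lt_top hK,
      ENNReal.mul_lt_top ENNReal.ofNat_lt_top ?_⟩
    have hle : ∫⁻ x in {x : ℝ | 1 < |x|},
        (∫⁻ s, ENNReal.ofReal (min 1 (f s * |x|))) ∂ν ≤
        ∫⁻ x in {x : ℝ | 1 < |x|}, (ENNReal.ofReal (Real.log |x|) * ENNReal.ofReal lam⁻¹
          + ∫⁻ s, ENNReal.ofReal (f s)) ∂ν := by
      refine setLIntegral_mono' measurableSet_one_lt_abs fun x hx => ?_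
      rw [← hlog]
      simp only [hf]
      exact lintegral_min_one_le hlam hx
    refine hle.trans_lt ?_
    rw [lintegral_add_right _ measurable_const, lintegral_mul_const' _ _ ENNReal.ofReal_ne_top,
      lintegral_const]
    exact ENNReal.add_lt_top.2 ⟨ENNReal.mul_lt_top h ENNReal.ofReal_lt_top,
      ENNReal.mul_lt_top hK (measure_lt_top _ _)⟩
end

section
/- Let γ ∈ ℝ, B ≥ 0, α > −1, and let ν be a Lévy measure on ℝ with ∫_{|x|>1} |x| ν(dx) < ∞. With τ(x) := x/(1 ∨ |x|) and H(r) := |γ r + ∫_ℝ (τ(xr) − r τ(x)) ν(dx)|, define Ψ(r) := sup_{|c| ≤ 1} H(cr) + B r² + ∫_ℝ (1 ∧ |rx|²) ν(dx) and Ψ₁(r) := sup_{|c| ≤ 1} H(cr) + B r² + ∫_ℝ (|rx| 𝟙_{|rx|>1} + |rx|² 𝟙_{|rx|≤1}) ν(dx). Let φ_α(s) := e^{−s} s^α for s > 0 and 0 otherwise. Then ∫_ℝ Ψ(φ_α(s)) ds < ∞ if and only if ∫_ℝ Ψ₁(φ_α(s)) ds < ∞. -/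
open MeasureTheory Set Real
open scoped ENNReal

/-- A Lévy measure is s-finite. -/
theorem sFinite_of_levy {ν : Measure ℝ} (h0 : ν {0} = 0)
    (h : ∫⁻ x, ENNReal.ofReal (min 1 (x ^ 2)) ∂ν < ⊤) : SFinite ν := by
  have : IsFiniteMeasure (ν.withDensity fun x => ENNReal.ofReal (min 1 (x ^ 2))) :=
    isFiniteMeasure_withDensity h.ne
  refine sFinite_of_absolutelyContinuous (withDensity_absolutelyContinuous'
    (by fun_prop : Measurable fun x : ℝ => ENNReal.ofReal (min 1 (x ^ 2))).aemeasurable ?_)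
  filter_upwards [measure_eq_zero_iff_ae_notMem.1 h0] with x hx
  have hx0 : x ≠ 0 := hx
  rw [ne_eq, ENNReal.ofReal_eq_zero, not_le]
  positivity

/-- The gamma kernel with a nonnegative exponent is bounded. -/
theorem exists_exp_neg_mul_rpow_le {α : ℝ} (hα : 0 ≤ α) :
    ∃ M : ℝ, 0 ≤ M ∧ ∀ s : ℝ, 0 < s → exp (-s) * s ^ α ≤ M := by
  refine ⟨1 + (⌈α⌉₊.factorial : ℝ), by positivity, fun s hs => ?_⟩
  have h1 : s ^ α ≤ 1 + s ^ ⌈α⌉₊ := by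
    rcases le_total s 1 with h | h
    · have := rpow_le_one hs.le h hα
      have : 0 ≤ s ^ ⌈α⌉₊ := by positivity
      linarith
    · have := rpow_le_rpow_of_exponent_le h (Nat.le_ceil α)
      rw [rpow_natCast] at this
      linarith
  have h2 : s ^ ⌈α⌉₊ ≤ (⌈α⌉₊.factorial : ℝ) * exp s := by
    have := pow_div_factorial_le_exp s hs.le ⌈α⌉₊
    rwa [div_le_iff₀' (by positivity)] at this
  have h3 : 1 ≤ exp s := one_le_exp hs.le
  rw [exp_neg, inv_mul_le_iff₀ (exp_pos s)]
  nlinarith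

theorem setLIntegral_Ioc_rpow_mul {α : ℝ} (hα : -1 < α) (hα0 : α < 0) {y : ℝ} (hy : 0 < y) :
    ∫⁻ s in Ioc 0 (y ^ (-α⁻¹)), ENNReal.ofReal (s ^ α * y)
      = ENNReal.ofReal (y ^ (-α⁻¹) / (α + 1)) := by
  set b := y ^ (-α⁻¹) with hb
  have hb0 : 0 < b := rpow_pos_of_pos hy _
  have hi : IntervalIntegrable (fun s : ℝ => s ^ α * y) volume 0 b :=
    (intervalIntegral.intervalIntegrable_rpow' hα).mul_const y
  rw [← ofReal_integral_eq_lintegral_ofReal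
    ((intervalIntegrable_iff_integrableOn_Ioc_of_le hb0.le).1 hi),
    ← intervalIntegral.integral_of_le hb0.le, intervalIntegral.integral_mul_const,
    integral_rpow (Or.inl hα)]
  · have : b ^ α = y⁻¹ := by
      rw [hb, ← rpow_mul hy.le, neg_mul, inv_mul_cancel₀ hα0.ne, rpow_neg_one]
    rw [rpow_add hb0, this, zero_rpow (by linarith), rpow_one]
    congr 1
    field_simp
    simp
  · filter_upwards [ae_restrict_mem measurableSet_Ioc] with s hs
    have := rpow_nonneg hs.1.le α
    positivity

theorem lt_rpow_neg_inv_iff {α : ℝ} (hα0 : α < 0) {s y : ℝ} (hs : 0 < s) (hy : 0 < y) :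
    s < y ^ (-α⁻¹) ↔ 1 < s ^ α * y := by
  rw [← inv_neg, lt_rpow_inv_iff_of_pos hs.le hy.le (by linarith), rpow_neg hs.le,
    inv_lt_iff_one_lt_mul₀ (rpow_pos_of_pos hs _), mul_comm]

/-- For a negative exponent, the truncated first moment of a small multiple of the gamma kernel
is controlled by its truncated second moment. -/
theorem lintegral_gamma_tail_le_of_neg {α : ℝ} (hα : -1 < α) (hα0 : α < 0) {φ : ℝ → ℝ}
    (hφ : ∀ s : ℝ, φ s = if 0 < s then exp (-s) * s ^ α else 0) {x : ℝ} (hx : |x| ≤ 1) :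
    ∫⁻ s, ENNReal.ofReal (if 1 < |φ s * x| then |φ s * x| else 0) ≤
      ENNReal.ofReal (exp 1 ^ (-α⁻¹) / (α + 1)) *
        ∫⁻ s, ENNReal.ofReal (min 1 ((φ s * x) ^ 2)) := by
  rcases eq_or_ne x 0 with rfl | hx0
  · simp
  have hy : 0 < |x| := abs_pos.2 hx0
  have habs : ∀ s, 0 < s → |φ s * x| = exp (-s) * (s ^ α * |x|) := fun s hs => by
    have := rpow_nonneg hs.le α
    rw [hφ, if_pos hs, abs_mul, abs_of_nonneg (by positivity), mul_assoc]
  have hα1 : 0 < α + 1 := by linarith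
  have upper : ∫⁻ s, ENNReal.ofReal (if 1 < |φ s * x| then |φ s * x| else 0) ≤
      ENNReal.ofReal (|x| ^ (-α⁻¹) / (α + 1)) := by
    rw [← setLIntegral_Ioc_rpow_mul hα hα0 hy, ← lintegral_indicator measurableSet_Ioc]
    refine lintegral_mono fun s => ?_
    dsimp only
    split_ifs with h
    · have hs : 0 < s := by
        by_contra hs
        rw [hφ, if_neg hs] at h
        norm_num at h
      have hle : |φ s * x| ≤ s ^ α * |x| := by
        rw [habs s hs]
        have := rpow_nonneg hs.le α
        exact mul_le_of_le_one_left (by positivity) (exp_le_one_iff.2 (by linarith))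
      rw [indicator_of_mem]
      · exact ENNReal.ofReal_le_ofReal hle
      · exact ⟨hs, ((lt_rpow_neg_inv_iff hα0 hs hy).2 (h.trans_le hle)).le⟩
    · simp
  have lower : ENNReal.ofReal ((|x| / exp 1) ^ (-α⁻¹)) ≤
      ∫⁻ s, ENNReal.ofReal (min 1 ((φ s * x) ^ 2)) := by
    set b := (|x| / exp 1) ^ (-α⁻¹) with hb
    have hb1 : b ≤ 1 := by
      refine rpow_le_one (by positivity) ?_ (by simpa using (inv_lt_zero.2 hα0).le)
      rw [div_le_one (exp_pos 1)]
      exact hx.trans (one_le_exp zero_le_one)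
    calc ENNReal.ofReal b = ∫⁻ s, (Ioo 0 b).indicator 1 s := by
          rw [lintegral_indicator_one measurableSet_Ioo, Real.volume_Ioo, sub_zero]
      _ ≤ _ := by
          refine lintegral_mono (indicator_le' (fun s hs => ?_) fun _ _ => zero_le)
          have h1 : 1 < s ^ α * (|x| / exp 1) :=
            (lt_rpow_neg_inv_iff hα0 hs.1 (by positivity)).1 hs.2
          have h2 : 1 ≤ |φ s * x| := by
            rw [habs s hs.1]
            have h3 : exp (-1) ≤ exp (-s) := exp_le_exp.2 (by linarith [hs.2])
            have : 1 < exp (-1) * (s ^ α * |x|) := by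
              rw [exp_neg]; convert h1 using 1; ring
            have := rpow_nonneg hs.1.le α
            nlinarith [mul_le_mul_of_nonneg_right h3 (by positivity : 0 ≤ s ^ α * |x|)]
          rw [min_eq_left ((one_le_sq_iff_one_le_abs _).2 h2)]
          simp
  refine upper.trans ((le_of_eq ?_).trans (mul_le_mul_right lower _))
  rw [← ENNReal.ofReal_mul (by positivity), div_rpow hy.le (exp_pos 1).le]
  congr 1
  have := rpow_pos_of_pos (exp_pos 1) (-α⁻¹)
  field_simp

/-- The truncated first moment of a small multiple of the gamma kernel is controlled by its
truncated second moment. -/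
theorem exists_lintegral_gamma_tail_le {α : ℝ} (hα : -1 < α) {φ : ℝ → ℝ}
    (hφ : ∀ s : ℝ, φ s = if 0 < s then exp (-s) * s ^ α else 0) :
    ∃ C : ℝ, ∀ x : ℝ, |x| ≤ 1 →
      ∫⁻ s, ENNReal.ofReal (if 1 < |φ s * x| then |φ s * x| else 0) ≤
        ENNReal.ofReal C * ∫⁻ s, ENNReal.ofReal (min 1 ((φ s * x) ^ 2)) := by
  rcases lt_or_ge α 0 with hα0 | hα0
  · exact ⟨_, fun x hx => lintegral_gamma_tail_le_of_neg hα hα0 hφ hx⟩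
  obtain ⟨M, hM, hMs⟩ := exists_exp_neg_mul_rpow_le hα0
  have hφM : ∀ s, |φ s| ≤ M := fun s => by
    rw [hφ]
    split_ifs with hs
    · have := rpow_nonneg hs.le α
      rw [abs_of_nonneg (by positivity)]
      exact hMs s hs
    · simpa using hM
  refine ⟨M, fun x hx => ?_⟩
  rw [← lintegral_const_mul' _ _ ENNReal.ofReal_ne_top]
  refine lintegral_mono fun s => ?_
  dsimp only
  split_ifs with h
  · rw [min_eq_left ((one_le_sq_iff_one_le_abs _).2 h.le), ENNReal.ofReal_one, mul_one]
    refine ENNReal.ofReal_le_ofReal ?_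
    rw [abs_mul]
    exact (mul_le_of_le_one_right (abs_nonneg _) hx).trans (hφM s)
  · simp

theorem measurable_gamma {α : ℝ} {φ : ℝ → ℝ}
    (hφ : ∀ s : ℝ, φ s = if 0 < s then exp (-s) * s ^ α else 0) : Measurable φ := by
  rw [funext hφ]
  exact Measurable.ite measurableSet_Ioi (by fun_prop) measurable_const

theorem measurable_ofReal_tail {φ : ℝ → ℝ} (hφ : Measurable φ) :
    Measurable fun p : ℝ × ℝ =>
      ENNReal.ofReal (if 1 < |φ p.1 * p.2| then |φ p.1 * p.2| else 0) :=
  ENNReal.measurable_ofReal.comp <| Measurable.ite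
    (measurableSet_lt measurable_const (by fun_prop)) (by fun_prop) measurable_const

/-- The gamma kernel is integrable. -/
theorem lintegral_gamma_lt_top {α : ℝ} (hα : -1 < α) {φ : ℝ → ℝ}
    (hφ : ∀ s : ℝ, φ s = if 0 < s then exp (-s) * s ^ α else 0) :
    ∫⁻ s, ENNReal.ofReal |φ s| < ⊤ := by
  have h := GammaIntegral_convergent (s := α + 1) (by linarith)
  rw [add_sub_cancel_right, ← integrable_indicator_iff measurableSet_Ioi] at h
  have : φ = (Ioi 0).indicator fun s => exp (-s) * s ^ α := by
    ext s
    rw [hφ, indicator_apply]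
    rfl
  rw [← this] at h
  exact hasFiniteIntegral_iff_norm _ |>.1 h.2

theorem lintegral_tail_lt_top {α : ℝ} (hα : -1 < α) {φ : ℝ → ℝ}
    (hφ : ∀ s : ℝ, φ s = if 0 < s then exp (-s) * s ^ α else 0) {ν : Measure ℝ} [SFinite ν]
    (hν_moment : ∫⁻ x in {x : ℝ | 1 < |x|}, ENNReal.ofReal |x| ∂ν < ⊤)
    (h : ∫⁻ s, ∫⁻ x, ENNReal.ofReal (min 1 ((φ s * x) ^ 2)) ∂ν < ⊤) :
    ∫⁻ s, ∫⁻ x, ENNReal.ofReal (if 1 < |φ s * x| then |φ s * x| else 0) ∂ν < ⊤ := by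
  have hφm := measurable_gamma hφ
  have hS : MeasurableSet {x : ℝ | 1 < |x|} := measurableSet_lt measurable_const (by fun_prop)
  have hmin : Measurable fun p : ℝ × ℝ => ENNReal.ofReal (min 1 ((φ p.1 * p.2) ^ 2)) := by
    fun_prop
  obtain ⟨C, hC⟩ := exists_lintegral_gamma_tail_le hα hφ
  rw [lintegral_lintegral_swap hmin.aemeasurable] at h
  rw [lintegral_lintegral_swap (measurable_ofReal_tail hφm).aemeasurable]
  have key : ∀ x, ∫⁻ s, ENNReal.ofReal (if 1 < |φ s * x| then |φ s * x| else 0) ≤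
      {x : ℝ | 1 < |x|}.indicator
        (fun x => (∫⁻ s, ENNReal.ofReal |φ s|) * ENNReal.ofReal |x|) x +
      ENNReal.ofReal C * ∫⁻ s, ENNReal.ofReal (min 1 ((φ s * x) ^ 2)) := fun x => by
    rcases le_or_gt |x| 1 with hx | hx
    · exact (hC x hx).trans le_add_self
    · refine le_trans ?_ le_self_add
      rw [indicator_of_mem (by exact hx), ← lintegral_mul_const' _ _ ENNReal.ofReal_ne_top]
      refine lintegral_mono fun s => ?_
      rw [← ENNReal.ofReal_mul (abs_nonneg _), ← abs_mul]
      refine ENNReal.ofReal_le_ofReal ?_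
      split_ifs
      · exact le_rfl
      · positivity
  refine (lintegral_mono key).trans_lt ?_
  rw [lintegral_add_left ((by fun_prop : Measurable _).indicator hS), lintegral_indicator hS,
    lintegral_const_mul' _ _ (lintegral_gamma_lt_top hα hφ).ne,
    lintegral_const_mul' _ _ ENNReal.ofReal_ne_top]
  exact ENNReal.add_lt_top.2 ⟨ENNReal.mul_lt_top (lintegral_gamma_lt_top hα hφ) hν_moment,
    ENNReal.mul_lt_top ENNReal.ofReal_lt_top h⟩

theorem measurable_ite_abs_mul {f : ℝ → ℝ} (hf : Measurable f) (r : ℝ) :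
    Measurable fun x : ℝ => if 1 < |r * x| then |r * x| else f x :=
  Measurable.ite (measurableSet_lt measurable_const (by fun_prop)) (by fun_prop) hf

theorem integrable_ite_abs_mul_sq {ν : Measure ℝ}
    (hν_levy : ∫⁻ x, ENNReal.ofReal (min 1 (x ^ 2)) ∂ν < ⊤)
    (hν_moment : ∫⁻ x in {x : ℝ | 1 < |x|}, ENNReal.ofReal |x| ∂ν < ⊤) (r : ℝ) :
    Integrable (fun x => if 1 < |r * x| then |r * x| else (r * x) ^ 2) ν := by
  have hS : MeasurableSet {x : ℝ | 1 < |x|} := measurableSet_lt measurable_const (by fun_prop)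
  have h1 : Integrable (fun x : ℝ => min 1 (x ^ 2)) ν := by
    refine ⟨(by fun_prop : Measurable _).aestronglyMeasurable, ?_⟩
    rwa [hasFiniteIntegral_iff_ofReal (ae_of_all _ fun x => by positivity)]
  have h2 : IntegrableOn (fun x : ℝ => |x|) {x : ℝ | 1 < |x|} ν := by
    refine ⟨(by fun_prop : Measurable _).aestronglyMeasurable, ?_⟩
    rwa [hasFiniteIntegral_iff_ofReal (ae_of_all _ fun x => by positivity)]
  refine ((h1.const_mul (r ^ 2)).add ((h2.integrable_indicator hS).const_mul |r|)).mono'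
    (measurable_ite_abs_mul (by fun_prop) r).aestronglyMeasurable (ae_of_all _ fun x => ?_)
  rw [norm_of_nonneg (by positivity)]
  simp only [Pi.add_apply]
  rcases le_or_gt |x| 1 with hx | hx
  · rw [indicator_of_notMem (by simpa using hx), min_eq_right ((sq_le_one_iff_abs_le_one x).2 hx),
      mul_zero, add_zero, ← mul_pow]
    split_ifs with h
    · rw [← sq_abs]
      nlinarith
    · exact le_rfl
  · rw [indicator_of_mem (by exact hx), ← abs_mul]
    have : 0 ≤ r ^ 2 * min 1 (x ^ 2) := by positivity
    split_ifs with h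
    · linarith
    · rw [← sq_abs]
      nlinarith [abs_nonneg (r * x)]

/-- first assertion of Theorem 4.2 of the paper.
If the Lévy measure `ν` has a finite first moment outside the unit ball, then for
the gamma kernel `φ_α` membership in the Orlicz class of `Ψ` is equivalent to
membership in the Orlicz class of `Ψ₁` (integrands with finite first moment). -/
theorem gamma_kernel_orlicz_iff_orlicz_one
    (γ : ℝ) (B : ℝ) (hB : 0 ≤ B) (α : ℝ) (hα : -1 < α)
    (ν : Measure ℝ)
    (hν_zero : ν {0} = 0)
    (hν_levy : ∫⁻ x, ENNReal.ofReal (min 1 (x ^ 2)) ∂ν < ⊤)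
    (hν_moment : ∫⁻ x in {x : ℝ | 1 < |x|}, ENNReal.ofReal |x| ∂ν < ⊤)
    (τ : ℝ → ℝ) (hτ : ∀ x, τ x = x / max 1 |x|)
    (H : ℝ → ℝ)
    (hH : ∀ r : ℝ, H r = |γ * r + ∫ x, (τ (x * r) - r * τ x) ∂ν|)
    (Ψ : ℝ → ℝ)
    (hΨ : ∀ r : ℝ, Ψ r =
      sSup {y : ℝ | ∃ c : ℝ, |c| ≤ 1 ∧ y = H (c * r)}
        + B * r ^ 2 + ∫ x, min 1 ((r * x) ^ 2) ∂ν)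
    (Ψ₁ : ℝ → ℝ)
    (hΨ₁ : ∀ r : ℝ, Ψ₁ r =
      sSup {y : ℝ | ∃ c : ℝ, |c| ≤ 1 ∧ y = H (c * r)}
        + B * r ^ 2 + ∫ x, (if 1 < |r * x| then |r * x| else (r * x) ^ 2) ∂ν)
    (φ : ℝ → ℝ) (hφ : ∀ s : ℝ, φ s = if 0 < s then Real.exp (-s) * s ^ α else 0) :
    (∫⁻ s, ENNReal.ofReal (Ψ (φ s)) < ⊤) ↔
      (∫⁻ s, ENNReal.ofReal (Ψ₁ (φ s)) < ⊤) := by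
  have := sFinite_of_levy hν_zero hν_levy
  have hint₁ := integrable_ite_abs_mul_sq hν_levy hν_moment
  have hle : ∀ r x : ℝ, min 1 ((r * x) ^ 2) ≤ if 1 < |r * x| then |r * x| else (r * x) ^ 2 :=
    fun r x => by
      split_ifs with h
      · exact (min_le_left _ _).trans h.le
      · exact min_le_right _ _
  have hint : ∀ r, Integrable (fun x => min 1 ((r * x) ^ 2)) ν := fun r =>
    (hint₁ r).mono' (by fun_prop : Measurable _).aestronglyMeasurable (ae_of_all _ fun x => by
      rw [norm_of_nonneg (by positivity)]
      exact hle r x)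
  have hK : ∀ r, Integrable (fun x => if 1 < |r * x| then |r * x| else 0) ν := fun r =>
    (hint₁ r).mono' (measurable_ite_abs_mul measurable_const r).aestronglyMeasurable
      (ae_of_all _ fun x => by
        rw [norm_of_nonneg (by split_ifs <;> positivity)]
        split_ifs
        · exact le_rfl
        · positivity)
  have hdrift : ∀ r, 0 ≤ sSup {y : ℝ | ∃ c : ℝ, |c| ≤ 1 ∧ y = H (c * r)} + B * r ^ 2 := fun r => by
    refine add_nonneg (Real.sSup_nonneg ?_) (by positivity)
    rintro _ ⟨c, -, rfl⟩
    rw [hH]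
    exact abs_nonneg _
  constructor
  · intro h
    have hmin : ∫⁻ s, ∫⁻ x, ENNReal.ofReal (min 1 ((φ s * x) ^ 2)) ∂ν < ⊤ := by
      refine (lintegral_mono fun s => ?_).trans_lt h
      rw [← ofReal_integral_eq_lintegral_ofReal (hint _) (ae_of_all _ fun x => by positivity), hΨ]
      exact ENNReal.ofReal_le_ofReal (le_add_of_nonneg_left (hdrift _))
    have htail := lintegral_tail_lt_top hα hφ hν_moment hmin
    have hmeas : Measurable fun s =>
        ∫⁻ x, ENNReal.ofReal (if 1 < |φ s * x| then |φ s * x| else 0) ∂ν :=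
      (measurable_ofReal_tail (measurable_gamma hφ)).lintegral_prod_right'
    refine (lintegral_mono fun s => ?_).trans_lt
      ((lintegral_add_right _ hmeas).trans_lt (ENNReal.add_lt_top.2 ⟨h, htail⟩))
    rw [← ofReal_integral_eq_lintegral_ofReal (hK _)
      (ae_of_all _ fun x => by dsimp only; split_ifs <;> positivity)]
    refine (ENNReal.ofReal_le_ofReal ?_).trans ENNReal.ofReal_add_le
    rw [hΨ, hΨ₁, add_assoc _ (∫ x, _ ∂ν), ← integral_add (hint _) (hK _)]
    refine add_le_add_right (integral_mono (hint₁ _) ((hint _).add (hK _)) fun x => ?_) _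
    simp only [Pi.add_apply]
    split_ifs with h1
    · exact le_add_of_nonneg_left (by positivity)
    · rw [add_zero, min_eq_right ((sq_le_one_iff_abs_le_one _).2 (not_lt.1 h1))]
  · intro h
    refine (lintegral_mono fun s => ENNReal.ofReal_le_ofReal ?_).trans_lt h
    rw [hΨ, hΨ₁]
    exact add_le_add_right (integral_mono (hint _) (hint₁ _) (hle _)) _
end
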